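/- Let G be a finite undirected simple graph with no isolated vertices, let l be a positive integer and k an integer with k > 2. Let T be the graph obtained by fully connecting a complete simple graph K_k on k vertices with an independent set I on k+1 vertices, and let G'' be the disjoint union of G and T. Then h(G,l) ≤ k if and only if h(G'', l+2) ≤ k. -/

import Mathlib

/-- `nbhd adj A` is the set of vertices having at least one neighbor in `A`
(for the symmetric adjacency relation `adj`, which may have loops). -/
def nbhd {V : Type*} (adj : V → V → Prop) (A : Set V) : Set V :=
  {v | ∃ u ∈ A, adj u v}

/-- Rabbit territory at (0-indexed) time `t` against the hunter strategy `W`,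
when the rabbit may start anywhere in `S`.  (`terr adj S W (t-1)` is the set `R_t`
of the paper: `R_1 = S \ W_1`, `R_t = N(R_{t-1}) \ W_t`.) -/
def terr {V : Type*} (adj : V → V → Prop) (S : Set V) (W : ℕ → Set V) : ℕ → Set V
  | 0 => S \ W 0
  | t + 1 => nbhd adj (terr adj S W t) \ W (t + 1)

/-- The hunter strategy `W` uses at most `k` hunters. -/
def UsesAtMost {V : Type*} (W : ℕ → Set V) (k : ℕ) : Prop :=
  ∀ t, (W t).ncard ≤ k

/-- The hunting number when the rabbit is restricted to start in `S`:
the least `k` for which some strategy using `k` hunters empties the territory. -/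
noncomputable def huntingNumberFrom {V : Type*} (adj : V → V → Prop) (S : Set V) : ℕ :=
  sInf {k | ∃ W : ℕ → Set V, UsesAtMost W k ∧ ∃ T, terr adj S W T = ∅}

/-- The hunting number `h(G)`. -/
noncomputable def huntingNumber {V : Type*} (adj : V → V → Prop) : ℕ :=
  huntingNumberFrom adj Set.univ

/-- The hunting number with time limit `l ≥ 1`, `h(G,l)`:
the strategy `W_1, …, W_l` corresponds to indices `0, …, l-1`, and the rabbit must be
caught by round `l`, i.e. `R_l = terr … (l-1) = ∅`. -/
noncomputable def huntingNumberTL {V : Type*} (adj : V → V → Prop) (l : ℕ) : ℕ :=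
  sInf {k | ∃ W : ℕ → Set V, UsesAtMost W k ∧ terr adj Set.univ W (l - 1) = ∅}

/-- The graph `T`: a complete simple graph `K_k` fully connected to an
independent set `I` on `k + 1` vertices. -/
def adjT (k : ℕ) : Fin k ⊕ Fin (k + 1) → Fin k ⊕ Fin (k + 1) → Prop
  | Sum.inl i, Sum.inl j => i ≠ j
  | Sum.inl _, Sum.inr _ => True
  | Sum.inr _, Sum.inl _ => True
  | Sum.inr _, Sum.inr _ => False

/-- The disjoint union of two graphs. -/
def adjDisjUnion {V U : Type*} (adjG : V → V → Prop) (adjH : U → U → Prop) :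
    V ⊕ U → V ⊕ U → Prop
  | Sum.inl a, Sum.inl b => adjG a b
  | Sum.inr a, Sum.inr b => adjH a b
  | Sum.inl _, Sum.inr _ => False
  | Sum.inr _, Sum.inl _ => False

section Territory

variable {V : Type*} {adj : V → V → Prop}

theorem nbhd_mono {A B : Set V} (h : A ⊆ B) : nbhd adj A ⊆ nbhd adj B :=
  fun _ ⟨u, hu, huv⟩ => ⟨u, h hu, huv⟩

/-- The territory after `t` hunter moves, where the rabbit moves before every hunter move and
starts anywhere. -/
def territory (adj : V → V → Prop) (W : ℕ → Set V) : ℕ → Set V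
  | 0 => Set.univ
  | t + 1 => nbhd adj (territory adj W t) \ W t

theorem terr_eq_territory (h : nbhd adj Set.univ = Set.univ) (W : ℕ → Set V) (t : ℕ) :
    terr adj Set.univ W t = territory adj W (t + 1) := by
  induction t with
  | zero => simp [terr, territory, h]
  | succ t ih => rw [terr, ih, ← territory]

theorem territory_congr {W W' : ℕ → Set V} {t : ℕ} (h : ∀ s < t, W s = W' s) :
    territory adj W t = territory adj W' t := by
  induction t with
  | zero => rfl
  | succ t ih =>
    rw [territory, territory, ih fun s hs => h s (by omega), h t (by omega)]

/-- `Confines adj k t B` says that `k` hunters can confine the rabbit to `B` in `t` moves. -/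
def Confines (adj : V → V → Prop) (k t : ℕ) (B : Set V) : Prop :=
  ∃ W : ℕ → Set V, UsesAtMost W k ∧ territory adj W t ⊆ B

theorem Confines.mono {k t : ℕ} {A B : Set V} (hA : Confines adj k t A) (h : A ⊆ B) :
    Confines adj k t B :=
  let ⟨W, hW, hWA⟩ := hA
  ⟨W, hW, hWA.trans h⟩

theorem Confines.step {k t : ℕ} {A U : Set V} (hA : Confines adj k t A) (hU : U.ncard ≤ k) :
    Confines adj k (t + 1) (nbhd adj A \ U) := by
  obtain ⟨W, hW, hWA⟩ := hA
  refine ⟨Function.update W t U, fun s => ?_, ?_⟩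
  · by_cases h : s = t
    · subst h; simpa using hU
    · simpa [h] using hW s
  · rw [territory, Function.update_self,
      territory_congr (W' := W) fun s hs => Function.update_of_ne hs.ne _ _]
    exact Set.sdiff_subset_sdiff_left (nbhd_mono hWA)

theorem huntingNumberTL_le_iff [Finite V] (h : nbhd adj Set.univ = Set.univ) {l k : ℕ}
    (hl : 1 ≤ l) : huntingNumberTL adj l ≤ k ↔ Confines adj k l ∅ := by
  have key (n : ℕ) : (∃ W : ℕ → Set V, UsesAtMost W n ∧ terr adj Set.univ W (l - 1) = ∅) ↔
      Confines adj n l ∅ := by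
    simp only [terr_eq_territory h, Nat.sub_add_cancel hl, Confines, Set.subset_empty_iff]
  have hne : {n | Confines adj n l ∅}.Nonempty := by
    refine ⟨(Set.univ : Set V).ncard, fun _ => Set.univ, fun _ => le_rfl, ?_⟩
    obtain ⟨m, rfl⟩ : ∃ m, l = m + 1 := ⟨l - 1, by omega⟩
    simp [territory]
  simp only [huntingNumberTL, key]
  constructor
  · intro hk
    obtain ⟨W, hW, hWl⟩ := Nat.sInf_mem hne
    exact ⟨W, fun t => (hW t).trans hk, hWl⟩
  · exact fun hk => Nat.sInf_le hk

end Territory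

section DisjUnion

variable {V U : Type*} {adjG : V → V → Prop} {adjH : U → U → Prop}

theorem nbhd_disjUnion_inl (A : Set (V ⊕ U)) :
    Sum.inl ⁻¹' nbhd (adjDisjUnion adjG adjH) A = nbhd adjG (Sum.inl ⁻¹' A) := by
  ext v
  simp [nbhd, adjDisjUnion]

theorem nbhd_disjUnion_inr (A : Set (V ⊕ U)) :
    Sum.inr ⁻¹' nbhd (adjDisjUnion adjG adjH) A = nbhd adjH (Sum.inr ⁻¹' A) := by
  ext v
  simp [nbhd, adjDisjUnion]

theorem territory_disjUnion_inl (W : ℕ → Set (V ⊕ U)) (t : ℕ) :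
    Sum.inl ⁻¹' territory (adjDisjUnion adjG adjH) W t =
      territory adjG (fun s => Sum.inl ⁻¹' W s) t := by
  induction t with
  | zero => rfl
  | succ t ih => rw [territory, Set.preimage_sdiff, nbhd_disjUnion_inl, ih, territory]

theorem territory_disjUnion_inr (W : ℕ → Set (V ⊕ U)) (t : ℕ) :
    Sum.inr ⁻¹' territory (adjDisjUnion adjG adjH) W t =
      territory adjH (fun s => Sum.inr ⁻¹' W s) t := by
  induction t with
  | zero => rfl
  | succ t ih => rw [territory, Set.preimage_sdiff, nbhd_disjUnion_inr, ih, territory]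

theorem nbhd_disjUnion_univ (hG : nbhd adjG Set.univ = Set.univ)
    (hH : nbhd adjH Set.univ = Set.univ) :
    nbhd (adjDisjUnion adjG adjH) Set.univ = Set.univ := by
  ext x
  rcases x with x | x
  · rw [← Set.mem_preimage, nbhd_disjUnion_inl, Set.preimage_univ, hG]; simp
  · rw [← Set.mem_preimage, nbhd_disjUnion_inr, Set.preimage_univ, hH]; simp

theorem ncard_preimage_inl_add_ncard_preimage_inr [Finite V] [Finite U] (X : Set (V ⊕ U)) :
    (Sum.inl ⁻¹' X : Set V).ncard + (Sum.inr ⁻¹' X : Set U).ncard = X.ncard := by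
  rw [← Set.ncard_image_of_injective (Sum.inl ⁻¹' X) (Sum.inl_injective (α := V) (β := U)),
    ← Set.ncard_image_of_injective (Sum.inr ⁻¹' X) (Sum.inr_injective (α := V) (β := U)),
    ← Set.ncard_union_eq, Set.image_preimage_inl_union_image_preimage_inr]
  exact Set.disjoint_image_inl_image_inr

end DisjUnion

section AdjT

variable {k : ℕ}

theorem nbhd_adjT_eq_univ {X : Set (Fin k ⊕ Fin (k + 1))} {v : Fin k} (hv : Sum.inl v ∈ X)
    (hX : 1 < X.ncard) : nbhd (adjT k) X = Set.univ := by
  obtain ⟨p, hp, hpv⟩ := Set.exists_ne_of_one_lt_ncard hX (Sum.inl v)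
  refine Set.eq_univ_of_forall fun x => ?_
  rcases x with j | j
  · by_cases hj : v = j
    · refine ⟨p, hp, ?_⟩
      rcases p with u | u
      · exact fun h => hpv (by rw [h, hj])
      · trivial
    · exact ⟨_, hv, hj⟩
  · exact ⟨_, hv, trivial⟩

theorem nbhd_adjT_univ (hk : 2 ≤ k) : nbhd (adjT k) Set.univ = Set.univ :=
  nbhd_adjT_eq_univ (v := ⟨0, by omega⟩) (Set.mem_univ _) (by simp [Set.ncard_univ]; omega)

theorem nbhd_adjT_singleton (v : Fin k) : nbhd (adjT k) {Sum.inl v} = {Sum.inl v}ᶜ := by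
  ext x
  rcases x with j | j <;> simp [nbhd, adjT, eq_comm]

theorem nbhd_adjT_of_subset_range_inr {X : Set (Fin k ⊕ Fin (k + 1))}
    (hX : X ⊆ Set.range Sum.inr) (hne : X.Nonempty) :
    nbhd (adjT k) X = Set.range Sum.inl := by
  obtain ⟨p, hp⟩ := hne
  ext x
  constructor
  · rintro ⟨u, hu, hux⟩
    obtain ⟨i, rfl⟩ := hX hu
    rcases x with j | j
    · exact ⟨j, rfl⟩
    · exact hux.elim
  · rintro ⟨j, rfl⟩
    obtain ⟨i, rfl⟩ := hX hp
    exact ⟨_, hp, trivial⟩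

/-- Hunters facing a rabbit that may be almost anywhere in `T` can only leave it in the independent
set by occupying almost all of the clique. -/
theorem diff_subset_range_inr_or_nbhd_eq_univ (hk : 2 ≤ k) {Z Y : Set (Fin k ⊕ Fin (k + 1))}
    (hZ : Zᶜ.ncard ≤ 1) (hY : Y.ncard ≤ k) :
    (Z \ Y ⊆ Set.range Sum.inr ∧ (Z \ Y).Nonempty ∧ k ≤ Y.ncard + Zᶜ.ncard) ∨
      nbhd (adjT k) (Z \ Y) = Set.univ := by
  have hZc : Z.ncard + Zᶜ.ncard = 2 * k + 1 := by
    rw [Set.ncard_add_ncard_compl]; simp; omega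
  have hcard : 1 < (Z \ Y).ncard := by
    have := Set.le_ncard_sdiff Y Z
    omega
  by_cases h : ∃ v, Sum.inl v ∈ Z \ Y
  · obtain ⟨v, hv⟩ := h
    exact .inr (nbhd_adjT_eq_univ hv hcard)
  · push Not at h
    refine .inl ⟨?_, Set.nonempty_of_ncard_ne_zero (by omega), ?_⟩
    · rintro (v | v) hv
      · exact absurd hv (h v)
      · exact ⟨v, rfl⟩
    · have hsub : Set.range (Sum.inl : Fin k → Fin k ⊕ Fin (k + 1)) ⊆ Y ∪ Zᶜ := by
        rintro _ ⟨v, rfl⟩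
        have := h v
        simp only [Set.mem_sdiff, not_and, not_not] at this
        by_cases hv : Sum.inl v ∈ Z
        · exact .inl (this hv)
        · exact .inr hv
      have hr : (Set.range (Sum.inl : Fin k → Fin k ⊕ Fin (k + 1))).ncard = k := by
        rw [← Set.image_univ, Set.ncard_image_of_injective _ Sum.inl_injective]
        simp
      exact hr.symm.le.trans <| (Set.ncard_le_ncard hsub).trans (Set.ncard_union_le _ _)

theorem range_inl_diff_cases (Y : Set (Fin k ⊕ Fin (k + 1))) :
    (Set.range Sum.inl \ Y = ∅ ∧ k ≤ Y.ncard) ∨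
      (∃ v, Set.range Sum.inl \ Y = {Sum.inl v} ∧ k ≤ Y.ncard + 1) ∨
      nbhd (adjT k) (Set.range Sum.inl \ Y) = Set.univ := by
  have hr : (Set.range (Sum.inl : Fin k → Fin k ⊕ Fin (k + 1))).ncard = k := by
    rw [← Set.image_univ, Set.ncard_image_of_injective _ Sum.inl_injective]
    simp
  have hle := Set.le_ncard_sdiff Y (Set.range (Sum.inl : Fin k → Fin k ⊕ Fin (k + 1)))
  rcases (Set.range Sum.inl \ Y).eq_empty_or_nonempty with h | ⟨_, ⟨v, rfl⟩, hv⟩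
  · rw [h, Set.ncard_empty] at hle
    exact .inl ⟨h, by omega⟩
  · have hmem : Sum.inl v ∈ Set.range Sum.inl \ Y := ⟨⟨v, rfl⟩, hv⟩
    by_cases h1 : 1 < (Set.range Sum.inl \ Y).ncard
    · exact .inr (.inr (nbhd_adjT_eq_univ hmem h1))
    · refine .inr (.inl ⟨v, ?_, by omega⟩)
      refine Set.eq_singleton_iff_unique_mem.2 ⟨hmem, fun x hx => ?_⟩
      exact (Set.ncard_le_one_iff).1 (not_lt.1 h1) hx hmem

end AdjT

section Main

variable {V : Type*} {adj : V → V → Prop} {k : ℕ}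

/-- What the hunters have achieved on `G` (territory `A`) after `t` moves on `G ⊔ T`, depending on
the shape of the territory `R` in `T`. -/
inductive Progress (adj : V → V → Prop) (k : ℕ) :
    ℕ → Set V → Set (Fin k ⊕ Fin (k + 1)) → Prop
  | full {t A R} (hR : nbhd (adjT k) R = Set.univ) (hA : Confines adj k t A) : Progress adj k t A R
  | independent {t A R} {D w : Set V} (hR : R ⊆ Set.range Sum.inr) (hne : R.Nonempty)
      (hw : w.ncard ≤ 1) (hD : Confines adj k t D) (hA : nbhd adj D \ w ⊆ A)
      (hDw : ∀ d ∈ D, ∃ e ∉ w, adj d e) : Progress adj k (t + 1) A R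
  | singleton {t A R} {D w w' : Set V} (v : Fin k) (hR : R = {Sum.inl v})
      (hw : w.ncard ≤ 1) (hw' : w'.ncard ≤ 1) (hD : Confines adj k t D)
      (hA : nbhd adj (nbhd adj D \ w) \ w' ⊆ A) : Progress adj k (t + 2) A R
  | empty {t A R} (hR : R = ∅) (hA : Confines adj k t A) : Progress adj k (t + 2) A R

theorem Progress.step [Finite V] (hsymm : ∀ u v, adj u v → adj v u) (hniso : ∀ v, ∃ u, adj v u)
    (hk : 2 ≤ k) {t : ℕ} {A : Set V} {R : Set (Fin k ⊕ Fin (k + 1))}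
    (h : Progress adj k t A R) (hAt : Confines adj k t A) {X : Set V}
    {Y : Set (Fin k ⊕ Fin (k + 1))} (hXY : X.ncard + Y.ncard ≤ k) :
    Progress adj k (t + 1) (nbhd adj A \ X) (nbhd (adjT k) R \ Y) := by
  have hA' : Confines adj k (t + 1) (nbhd adj A \ X) := hAt.step (by omega)
  cases h with
  | full hR hA =>
    rcases diff_subset_range_inr_or_nbhd_eq_univ hk (Z := nbhd (adjT k) R) (Y := Y)
      (by simp [hR]) (by omega) with ⟨h1, h2, h3⟩ | h
    · rw [hR, Set.compl_univ, Set.ncard_empty] at h3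
      obtain rfl : X = ∅ := (Set.ncard_eq_zero).1 (by omega)
      exact .independent (w := ∅) h1 h2 (by simp) hAt subset_rfl fun d _ =>
        let ⟨e, he⟩ := hniso d
        ⟨e, by simp, he⟩
    · exact .full h hA'
  | independent hR hne hw hD hA hDw =>
    rw [nbhd_adjT_of_subset_range_inr hR hne]
    rcases range_inl_diff_cases Y with ⟨h, hY⟩ | ⟨v, h, hY⟩ | h
    · obtain rfl : X = ∅ := (Set.ncard_eq_zero).1 (by omega)
      refine .empty h (hD.mono fun d hd => ?_)
      obtain ⟨e, hew, hde⟩ := hDw d hd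
      exact ⟨⟨e, hA ⟨⟨d, hd, hde⟩, hew⟩, hsymm _ _ hde⟩, by simp⟩
    · exact .singleton v h hw (by omega) hD (Set.sdiff_subset_sdiff_left (nbhd_mono hA))
    · exact .full h hA'
  | @singleton s _ _ D w w' v hR hw hw' hD hA =>
    have hc : (nbhd (adjT k) R)ᶜ = {Sum.inl v} := by rw [hR, nbhd_adjT_singleton, compl_compl]
    rcases diff_subset_range_inr_or_nbhd_eq_univ hk (Z := nbhd (adjT k) R) (Y := Y)
      (by simp [hc]) (by omega) with ⟨h1, h2, h3⟩ | h
    · rw [hc, Set.ncard_singleton] at h3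
      have hX : X.ncard ≤ 1 := by omega
      have hwX : (w ∪ X).ncard ≤ k := (Set.ncard_union_le _ _).trans (by omega)
      refine .independent h1 h2 hX ((hD.step hwX).step (U := w') (by omega)) ?_ ?_
      · refine Set.sdiff_subset_sdiff_left (nbhd_mono (.trans ?_ hA))
        exact Set.sdiff_subset_sdiff_left
          (nbhd_mono (Set.sdiff_subset_sdiff_right Set.subset_union_left))
      · rintro d ⟨⟨e, ⟨_, he⟩, hed⟩, _⟩
        exact ⟨e, fun h => he (.inr h), hsymm _ _ hed⟩
    · exact .full h hA'
  | empty hR hA =>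
    refine .empty ?_ (hA.step (by omega))
    simp [hR, nbhd]

theorem Confines.of_disjUnion_adjT [Finite V] (hsymm : ∀ u v, adj u v → adj v u)
    (hniso : ∀ v, ∃ u, adj v u) (hk : 2 ≤ k) {l : ℕ}
    (h : Confines (adjDisjUnion adj (adjT k)) k (l + 2) ∅) : Confines adj k l ∅ := by
  obtain ⟨W, hW, hWl⟩ := h
  set X : ℕ → Set V := fun s => Sum.inl ⁻¹' W s
  set Y : ℕ → Set (Fin k ⊕ Fin (k + 1)) := fun s => Sum.inr ⁻¹' W s
  have hXY (s : ℕ) : (X s).ncard + (Y s).ncard ≤ k :=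
    (ncard_preimage_inl_add_ncard_preimage_inr (W s)).trans_le (hW s)
  have hprog (t : ℕ) : Progress adj k t (territory adj X t) (territory (adjT k) Y t) := by
    induction t with
    | zero =>
      exact .full (nbhd_adjT_univ hk) ⟨X, fun s => by have := hXY s; omega, subset_rfl⟩
    | succ t ih =>
      exact ih.step hsymm hniso hk ⟨X, fun s => by have := hXY s; omega, subset_rfl⟩ (hXY t)
  have hX : territory adj X (l + 2) = ∅ := by
    rw [← territory_disjUnion_inl (adjH := adjT k) W, Set.subset_empty_iff.1 hWl,
      Set.preimage_empty]
  have hY : territory (adjT k) Y (l + 2) = ∅ := by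
    rw [← territory_disjUnion_inr (adjG := adj) W, Set.subset_empty_iff.1 hWl, Set.preimage_empty]
  have := hprog (l + 2)
  rw [hX, hY] at this
  cases this with
  | full hR =>
    have : (Sum.inr 0 : Fin k ⊕ Fin (k + 1)) ∈ nbhd (adjT k) ∅ := hR ▸ Set.mem_univ _
    simp [nbhd] at this
  | independent _ hne => exact absurd hne Set.not_nonempty_empty
  | singleton v hR => exact absurd hR.symm (Set.singleton_ne_empty _)
  | empty _ hA => exact hA

theorem Confines.disjUnion_adjT [Finite V] {l : ℕ} (h : Confines adj k l ∅) :
    Confines (adjDisjUnion adj (adjT k)) k (l + 2) ∅ := by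
  obtain ⟨W, hW, hWl⟩ := h
  have h₀ : Confines (adjDisjUnion adj (adjT k)) k l (Set.range Sum.inr) := by
    refine ⟨fun s => Sum.inl '' W s, fun s => ?_, ?_⟩
    · rw [Set.ncard_image_of_injective _ Sum.inl_injective]
      exact hW s
    · rintro (v | v) hv
      · rw [← Set.mem_preimage, territory_disjUnion_inl] at hv
        simp only [Set.preimage_image_eq _ Sum.inl_injective] at hv
        exact (hWl hv).elim
      · exact ⟨v, rfl⟩
  set K : Set (V ⊕ (Fin k ⊕ Fin (k + 1))) := Set.range (Sum.inr ∘ Sum.inl)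
  have hK : K.ncard ≤ k := by
    rw [show K = (Sum.inr ∘ Sum.inl) '' Set.univ from Set.image_univ.symm]
    exact (Set.ncard_image_le).trans (by simp)
  refine ((h₀.step hK).step hK).mono ?_
  rintro (v | v | v) ⟨⟨u, ⟨⟨p, ⟨q, rfl⟩, hp⟩, hu⟩, huv⟩, hv⟩
  · rcases u with u | u
    · exact hp
    · exact huv
  · exact hv ⟨v, rfl⟩
  · rcases u with u | u | u
    · exact huv
    · exact hu ⟨u, rfl⟩
    · exact huv

end Main

/-- for `k > 2` and `G'' = G ⊔ T` the disjoint union of `G` with `T`,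
`h(G,l) ≤ k` if and only if `h(G'', l+2) ≤ k`. -/
theorem time_limit_plus_two {V : Type*} [Fintype V]
    (G : SimpleGraph V) (hniso : ∀ v, ∃ u, G.Adj v u)
    (l k : ℕ) (hl : 1 ≤ l) (hk : 2 < k) :
    huntingNumberTL G.Adj l ≤ k ↔
      huntingNumberTL (adjDisjUnion G.Adj (adjT k)) (l + 2) ≤ k := by
  have hG : nbhd G.Adj Set.univ = Set.univ :=
    Set.eq_univ_of_forall fun v =>
      let ⟨u, hu⟩ := hniso v
      ⟨u, Set.mem_univ _, hu.symm⟩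
  rw [huntingNumberTL_le_iff hG hl,
    huntingNumberTL_le_iff (nbhd_disjUnion_univ hG (nbhd_adjT_univ hk.le)) (by omega)]
  exact ⟨fun h => h.disjUnion_adjT,
    fun h => h.of_disjUnion_adjT (fun _ _ h => h.symm) hniso hk.le⟩
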